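/- Let X be a compact Polish space, P = (X, d, x̄) a presentation of X, and F ⊆ X a nonempty countable closed subset. Then φ_P(F) is a successor ordinal, i.e. there is an ordinal β with φ_P(F) = β + 1. -/

import Mathlib

open Set Filter Topology

/-- A presentation `(X, d, x̄)` of a Polish space `X`: a complete metric `d`
compatible with the topology of `X`, together with a dense sequence `x̄`. -/
structure Presentation (X : Type) [TopologicalSpace X] where
  dist : X → X → ℝ
  seq : ℕ → X
  dist_self : ∀ x, dist x x = 0
  eq_of_dist_eq_zero : ∀ x y, dist x y = 0 → x = y
  dist_comm : ∀ x y, dist x y = dist y x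
  dist_triangle : ∀ x y z, dist x z ≤ dist x y + dist y z
  /-- `d` is compatible with the topology of `X`. -/
  isOpen_iff : ∀ s : Set X, IsOpen s ↔ ∀ x ∈ s, ∃ ε > 0, ∀ y, dist y x < ε → y ∈ s
  /-- `d` is complete. -/
  complete : ∀ u : ℕ → X, (∀ ε > 0, ∃ N, ∀ m ≥ N, ∀ n ≥ N, dist (u m) (u n) < ε) →
      ∃ x, ∀ ε > 0, ∃ N, ∀ n ≥ N, dist (u n) x < ε
  /-- the sequence `x̄` is dense. -/
  dense : ∀ x, ∀ ε > 0, ∃ i, dist x (seq i) < ε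

namespace Presentation

variable {X : Type} [TopologicalSpace X] (P : Presentation X)

/-- The open ball `B_P(n)`. -/
def ball (n : ℕ × ℕ) : Set X := {x | P.dist x (P.seq n.1) < (1/2 : ℝ) ^ (n.2 + 1)}

/-- The closed ball `B̄_P(n)`. -/
def cball (n : ℕ × ℕ) : Set X := {x | P.dist x (P.seq n.1) ≤ (1/2 : ℝ) ^ (n.2 + 1)}

/-- The relation `n ≺_P m`. -/
def prec (n m : ℕ × ℕ) : Prop := n.2 < m.2 ∧ P.cball m ⊆ P.ball n

/-- The relation `n ⋏_P m`. -/
def apart (n m : ℕ × ℕ) : Prop := P.cball n ∩ P.cball m = ∅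

/-- The code `A_F^P` of a closed set `F ⊆ X`. -/
def code (F : Set X) : Set (ℕ × ℕ) := {n | (P.ball n ∩ F).Nonempty}

/-- The derivative `D_P` on subsets of `ω × ω`. -/
def deriv (A : Set (ℕ × ℕ)) : Set (ℕ × ℕ) :=
  {n ∈ A | ∃ u ∈ A, ∃ v ∈ A, P.prec n u ∧ P.prec n v ∧ P.apart u v}

/-- The transfinite iterates `D_P^α(A)`. -/
noncomputable def derivIter (A : Set (ℕ × ℕ)) (α : Ordinal.{0}) : Set (ℕ × ℕ) :=
  Ordinal.limitRecOn α A (fun _ ih => P.deriv ih)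
    (fun o _ ih => ⋂ (β : {β : Ordinal.{0} // β < o}), ih β.1 β.2)

/-- The rank `|A|_P`: the least ordinal `α` with `D_P^α(A) = D_P^{α+1}(A)`. -/
noncomputable def rankA (A : Set (ℕ × ℕ)) : Ordinal.{0} :=
  sInf {α | P.derivIter A (α + 1) = P.derivIter A α}

/-- The rank `φ_P(F) = |A_F^P|_P` of a (countable closed) subset `F ⊆ X`. -/
noncomputable def phi (F : Set X) : Ordinal.{0} := P.rankA (P.code F)

/-- `A ⊆ ω × ω` is `P`-closed. -/
def PClosed (A : Set (ℕ × ℕ)) : Prop := ∀ n ∈ A, ∀ m, P.prec m n → m ∈ A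

/-- `A ⊆ ω × ω` is `P`-pruned. -/
def PPruned (A : Set (ℕ × ℕ)) : Prop := ∀ n ∈ A, ∃ m ∈ A, P.prec n m

/-- `A ⊆ ω × ω` is `P`-perfect. -/
def PPerfect (A : Set (ℕ × ℕ)) : Prop :=
  ∀ n ∈ A, ∃ u ∈ A, ∃ v ∈ A, P.prec n u ∧ P.prec n v ∧ P.apart u v

/-- The set `[A]_P` of `P`-compatible sequences lying in `A`. -/
def body (A : Set (ℕ × ℕ)) : Set (ℕ → ℕ × ℕ) :=
  {f | (∀ i, P.prec (f i) (f (i + 1))) ∧ ∀ i, f i ∈ A}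

/-- The set `F_A^P = π_P([A]_P)`: the points obtained as the unique point of
`⋂_i B_P(n_i)` for a `P`-compatible sequence `(n_i)` in `A`. -/
def limitSet (A : Set (ℕ × ℕ)) : Set X :=
  {x | ∃ f ∈ P.body A, ∀ i, x ∈ P.ball (f i)}

end Presentation

section CB

variable {X : Type} [TopologicalSpace X]

/-- The Cantor–Bendixson derivative: the set of limit points of `F` in `F`. -/
def cbDeriv (F : Set X) : Set X := {x ∈ F | AccPt x (𝓟 F)}

/-- The iterated Cantor–Bendixson derivatives `F^α`. -/
noncomputable def cbIter (F : Set X) (α : Ordinal.{0}) : Set X :=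
  Ordinal.limitRecOn α F (fun _ ih => cbDeriv ih)
    (fun o _ ih => ⋂ (β : {β : Ordinal.{0} // β < o}), ih β.1 β.2)

/-- The Cantor–Bendixson rank `|F|_CB`. -/
noncomputable def cbRank (F : Set X) : Ordinal.{0} :=
  sInf {α | cbIter F (α + 1) = cbIter F α}

/-- The `K_σ`-derivative of a subset `A ⊆ X`: the points of `A` having no open
neighborhood in the subspace `A` whose closure in `A` is compact. -/
def kDeriv (A : Set X) : Set X :=
  {x ∈ A | ∀ U : Set X, IsOpen U → x ∈ U → ¬ IsCompact (A ∩ closure (U ∩ A))}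

/-- The iterated `K_σ`-derivatives `X_α` of the space `X`. -/
noncomputable def kIter (X : Type) [TopologicalSpace X] (α : Ordinal.{0}) : Set X :=
  Ordinal.limitRecOn α Set.univ (fun _ ih => kDeriv ih)
    (fun o _ ih => ⋂ (β : {β : Ordinal.{0} // β < o}), ih β.1 β.2)

/-- The `K_σ`-rank `|X|_{K_σ}`. -/
noncomputable def kRank (X : Type) [TopologicalSpace X] : Ordinal.{0} :=
  sInf {α | kIter X (α + 1) = kIter X α}

end CB

namespace Presentation

variable {X : Type} [TopologicalSpace X] (P : Presentation X)

lemma isOpen_ball (n : ℕ × ℕ) : IsOpen (P.ball n) := by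
  rw [P.isOpen_iff]
  intro x hx
  refine ⟨(1/2 : ℝ) ^ (n.2 + 1) - P.dist x (P.seq n.1), sub_pos.2 hx, fun y hy => ?_⟩
  have := P.dist_triangle y x (P.seq n.1)
  change P.dist y (P.seq n.1) < _
  linarith

lemma isClosed_cball (n : ℕ × ℕ) : IsClosed (P.cball n) := by
  rw [← isOpen_compl_iff, P.isOpen_iff]
  intro x hx
  have hx' : (1/2 : ℝ) ^ (n.2 + 1) < P.dist x (P.seq n.1) := not_le.1 hx
  refine ⟨_, sub_pos.2 hx', fun y hy => ?_⟩
  have := P.dist_triangle x y (P.seq n.1)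
  have := P.dist_comm x y
  refine not_le.2 (?_ : _ < P.dist y (P.seq n.1))
  linarith

lemma ball_subset_cball (n : ℕ × ℕ) : P.ball n ⊆ P.cball n :=
  fun x (hx : P.dist x _ < _) => (hx.le : P.dist x _ ≤ _)

variable {P} in
lemma prec.trans {n m k : ℕ × ℕ} (h₁ : P.prec n m) (h₂ : P.prec m k) : P.prec n k :=
  ⟨h₁.1.trans h₂.1, h₂.2.trans ((P.ball_subset_cball m).trans h₁.2)⟩

/-- On a compact space, finitely many balls precede every ball of positive level. -/
lemma exists_finite_forall_prec [CompactSpace X] :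
    ∃ T : Set (ℕ × ℕ), T.Finite ∧ ∀ n : ℕ × ℕ, 0 < n.2 → ∃ m ∈ T, P.prec m n := by
  obtain ⟨t, ht⟩ := isCompact_univ.elim_finite_subcover (fun i => P.ball (i, 1))
    (fun i => P.isOpen_ball (i, 1)) fun x _ => by
      obtain ⟨i, hi⟩ := P.dense x ((1/2 : ℝ) ^ (1 + 1)) (by positivity)
      exact mem_iUnion.2 ⟨i, hi⟩
  refine ⟨(fun i => (i, 0)) '' (t : Set ℕ), t.finite_toSet.image _, fun n hn => ?_⟩
  obtain ⟨i, hi, hin⟩ := mem_iUnion₂.1 (ht (mem_univ (P.seq n.1)))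
  refine ⟨(i, 0), mem_image_of_mem _ hi, hn, fun y hy => ?_⟩
  have hy : P.dist y (P.seq n.1) ≤ (1/2 : ℝ) ^ (n.2 + 1) := hy
  have hin : P.dist (P.seq n.1) (P.seq i) < (1/2 : ℝ) ^ (1 + 1) := hin
  have hpow : (1/2 : ℝ) ^ (n.2 + 1) ≤ (1/2 : ℝ) ^ (1 + 1) :=
    pow_le_pow_of_le_one (by norm_num) (by norm_num) (by omega)
  have := P.dist_triangle y (P.seq n.1) (P.seq i)
  change P.dist y (P.seq i) < (1/2 : ℝ) ^ (0 + 1)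
  norm_num at *
  linarith

lemma deriv_subset (A : Set (ℕ × ℕ)) : P.deriv A ⊆ A := fun _ hn => hn.1

variable {P} in
lemma PClosed.deriv {A : Set (ℕ × ℕ)} (hA : P.PClosed A) : P.PClosed (P.deriv A) := by
  rintro n ⟨hn, u, hu, v, hv, hnu, hnv, huv⟩ m hm
  exact ⟨hA n hn m hm, u, hu, v, hv, hm.trans hnu, hm.trans hnv, huv⟩

lemma pClosed_code (F : Set X) : P.PClosed (P.code F) := by
  rintro n ⟨x, hx, hxF⟩ m hm
  exact ⟨x, hm.2 (P.ball_subset_cball n hx), hxF⟩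

lemma code_nonempty {F : Set X} (hF : F.Nonempty) : (P.code F).Nonempty := by
  obtain ⟨x, hx⟩ := hF
  obtain ⟨i, hi⟩ := P.dense x ((1/2 : ℝ) ^ (0 + 1)) (by positivity)
  exact ⟨(i, 0), x, hi, hx⟩

lemma derivIter_zero (A : Set (ℕ × ℕ)) : P.derivIter A 0 = A :=
  Ordinal.limitRecOn_zero ..

lemma derivIter_add_one (A : Set (ℕ × ℕ)) (α : Ordinal.{0}) :
    P.derivIter A (α + 1) = P.deriv (P.derivIter A α) :=
  Ordinal.limitRecOn_add_one ..

lemma derivIter_limit (A : Set (ℕ × ℕ)) {α : Ordinal.{0}} (hα : Order.IsSuccLimit α) :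
    P.derivIter A α = ⋂ β : {β : Ordinal.{0} // β < α}, P.derivIter A β.1 :=
  Ordinal.limitRecOn_limit _ _ _ _ hα

lemma derivIter_antitone (A : Set (ℕ × ℕ)) : Antitone (P.derivIter A) := by
  intro β α
  induction α using Ordinal.limitRecOn with
  | zero => intro h; rw [nonpos_iff_eq_zero.1 h]
  | add_one α ih =>
    intro h
    rcases h.eq_or_lt with rfl | h
    · exact le_rfl
    · rw [derivIter_add_one]
      exact (P.deriv_subset _).trans (ih (Order.lt_add_one_iff.1 h))
  | limit α hα ih =>
    intro h
    rcases h.eq_or_lt with rfl | h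
    · exact le_rfl
    · rw [derivIter_limit _ _ hα]
      exact iInter_subset (fun β : {β : Ordinal.{0} // β < α} => P.derivIter A β.1) ⟨β, h⟩

variable {P} in
lemma PClosed.derivIter {A : Set (ℕ × ℕ)} (hA : P.PClosed A) (α : Ordinal.{0}) :
    P.PClosed (P.derivIter A α) := by
  induction α using Ordinal.limitRecOn with
  | zero => rwa [derivIter_zero]
  | add_one α ih => rw [derivIter_add_one]; exact ih.deriv
  | limit α hα ih =>
    rw [derivIter_limit _ _ hα]
    intro n hn m hm
    exact mem_iInter.2 fun β => ih β.1 β.2 n (mem_iInter.1 hn β) m hm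

lemma exists_derivIter_add_one_eq (A : Set (ℕ × ℕ)) :
    ∃ α : Ordinal.{0}, P.derivIter A (α + 1) = P.derivIter A α := by
  by_contra! h
  have key : ∀ β α : Ordinal.{0}, β < α → P.derivIter A β ≠ P.derivIter A α := by
    intro β α hlt heq
    refine h β ((P.derivIter_antitone A (le_add_of_nonneg_right zero_le_one)).antisymm ?_)
    rw [heq]
    exact P.derivIter_antitone A (Order.add_one_le_of_lt hlt)
  refine not_injective_of_ordinal (P.derivIter A) fun β α heq => ?_
  rcases lt_trichotomy β α with hlt | rfl | hlt
  · exact (key _ _ hlt heq).elim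
  · rfl
  · exact (key _ _ hlt heq.symm).elim

lemma derivIter_rankA (A : Set (ℕ × ℕ)) :
    P.derivIter A (P.rankA A + 1) = P.derivIter A (P.rankA A) :=
  csInf_mem (P.exists_derivIter_add_one_eq A)

/-- On a compact space, the code of a countable closed set has no nonempty `P`-perfect subset. -/
lemma PPerfect.eq_empty [CompactSpace X] {F : Set X} (hF : IsClosed F) (hcnt : F.Countable)
    {A : Set (ℕ × ℕ)} (hAF : A ⊆ P.code F) (hA : P.PPerfect A) : A = ∅ := by
  by_contra hne
  obtain ⟨a, ha⟩ := nonempty_iff_ne_empty.2 hne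
  obtain ⟨x₀, -, hx₀⟩ := hAF ha
  obtain ⟨e, rfl⟩ := hcnt.exists_eq_range ⟨x₀, hx₀⟩
  have step : ∀ (k : ℕ) (n : A), ∃ m : A, P.prec n.1 m.1 ∧ e k ∉ P.cball m.1 := by
    rintro k ⟨n, hn⟩
    obtain ⟨u, hu, v, hv, hnu, hnv, huv⟩ := hA n hn
    by_cases hk : e k ∈ P.cball u
    · refine ⟨⟨v, hv⟩, hnv, fun hk' => ?_⟩
      exact (huv.subset ⟨hk, hk'⟩ : e k ∈ (∅ : Set X))
    · exact ⟨⟨u, hu⟩, hnu, hk⟩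
  choose g hg hge using step
  let s : ℕ → A := fun k => Nat.rec ⟨a, ha⟩ g k
  obtain ⟨x, hx⟩ := IsCompact.nonempty_iInter_of_sequence_nonempty_isCompact_isClosed
    (fun k => P.cball (s k).1 ∩ range e)
    (fun k => inter_subset_inter_left _ ((hg k (s k)).2.trans (P.ball_subset_cball _)))
    (fun k => (hAF (s k).2).mono (inter_subset_inter_left _ (P.ball_subset_cball _)))
    ((P.isClosed_cball _).inter hF).isCompact
    (fun k => (P.isClosed_cball _).inter hF)
  rw [mem_iInter] at hx
  obtain ⟨k, rfl⟩ := (hx 0).2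
  exact hge k (s k) (hx (k + 1)).1

/-- On a compact space, the iterated derivatives of a `P`-closed set do not become empty for the
first time at a limit stage. -/
lemma PClosed.derivIter_limit_nonempty [CompactSpace X] {A : Set (ℕ × ℕ)} (hA : P.PClosed A)
    {α : Ordinal.{0}} (hα : Order.IsSuccLimit α) (h : ∀ β < α, (P.derivIter A β).Nonempty) :
    (P.derivIter A α).Nonempty := by
  obtain ⟨T, hT, hTn⟩ := P.exists_finite_forall_prec
  by_contra hempty
  have hout : ∀ m ∈ T, ∃ β < α, m ∉ P.derivIter A β := by
    intro m _
    by_contra! hm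
    refine hempty ⟨m, ?_⟩
    rw [derivIter_limit _ _ hα]
    exact mem_iInter.2 fun β => hm β.1 β.2
  choose! b hb hmb using hout
  obtain ⟨β, hβ, hbβ⟩ : ∃ β < α, ∀ m ∈ T, b m ≤ β := by
    rcases T.eq_empty_or_nonempty with rfl | hTne
    · exact ⟨0, hα.bot_lt, by simp⟩
    · obtain ⟨m, hm, hmax⟩ := T.exists_max_image b hT hTne
      exact ⟨b m, hb m hm, hmax⟩
  obtain ⟨n, hn⟩ := h (β + 1) (hα.add_one_lt hβ)
  rw [derivIter_add_one] at hn
  obtain ⟨-, u, hu, -, -, hnu, -⟩ := hn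
  obtain ⟨m, hm, hmu⟩ := hTn u (Nat.zero_lt_of_lt hnu.1)
  exact hmb m hm (P.derivIter_antitone A (hbβ m hm) (hA.derivIter β u hu m hmu))

lemma derivIter_phi_eq_empty [CompactSpace X] {F : Set X} (hF : IsClosed F)
    (hcnt : F.Countable) : P.derivIter (P.code F) (P.phi F) = ∅ := by
  refine PPerfect.eq_empty P hF hcnt ?_ fun n hn => ?_
  · conv_rhs => rw [← P.derivIter_zero (P.code F)]
    exact P.derivIter_antitone _ zero_le
  · have h := P.derivIter_rankA (P.code F)
    rw [derivIter_add_one] at h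
    exact (h.symm.subset hn).2

lemma derivIter_nonempty_of_lt_rankA {A : Set (ℕ × ℕ)} {β : Ordinal.{0}} (hβ : β < P.rankA A) :
    (P.derivIter A β).Nonempty := by
  by_contra h
  rw [not_nonempty_iff_eq_empty] at h
  refine notMem_of_lt_csInf' hβ (?_ : P.derivIter A (β + 1) = P.derivIter A β)
  rw [derivIter_add_one, h]
  exact subset_empty_iff.1 (P.deriv_subset ∅)

end Presentation

/-- For a compact Polish space `X`, any presentation `P` and any nonempty
countable closed `F ⊆ X`, `φ_P(F)` is a successor ordinal. -/
theorem stmt18 {X : Type} [TopologicalSpace X] [PolishSpace X] [CompactSpace X]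
    (P : Presentation X) (F : Set X) (hF : IsClosed F) (hcnt : F.Countable)
    (hne : F.Nonempty) :
    ∃ β : Ordinal.{0}, P.phi F = β + 1 := by
  rcases Ordinal.zero_or_succ_or_isSuccLimit (P.phi F) with h | ⟨β, h⟩ | h
  · have hempty := P.derivIter_phi_eq_empty hF hcnt
    rw [h, Presentation.derivIter_zero] at hempty
    exact ((P.code_nonempty hne).ne_empty hempty).elim
  · exact ⟨β, by simpa using h.symm⟩
  · refine (Set.Nonempty.ne_empty ?_ (P.derivIter_phi_eq_empty hF hcnt)).elim
    exact Presentation.PClosed.derivIter_limit_nonempty P (P.pClosed_code F) h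
      fun β hβ => P.derivIter_nonempty_of_lt_rankA hβ
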